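/- arXiv:2006.01891 — 7 statements merged into one kernel-verified Lean document; each statement's English description precedes it below -/
import Mathlib

section
/- Let F be a field of characteristic not equal to 2 and let F₁, …, Fₙ be field extensions of F such that (II) for every x ∈ F×, F× ∩ D_{F₁}⟨1,x⟩ ∩ … ∩ D_{Fₙ}⟨1,x⟩ = D_F⟨1,x⟩, and such that Fᵢ× = F×·(Fᵢ×)² for each i. Then the Kaplansky radical of F is R(F) = F× ∩ R(F₁) ∩ … ∩ R(Fₙ). -/
/-- `DSet F x` is the value set `D_F⟨1,x⟩` of the binary quadratic form `X² + xY²`. -/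
def DSet (F : Type*) [Field F] (x : F) : Set F :=
  {z : F | z ≠ 0 ∧ ∃ u v : F, z = u ^ 2 + x * v ^ 2}

/-- The Kaplansky radical `R(F)`. -/
def KRad (F : Type*) [Field F] : Set F :=
  {a : F | a ≠ 0 ∧ ∀ b : F, b ≠ 0 → ∃ u v : F, b = u ^ 2 - a * v ^ 2}

/-- Let `F` be a field of characteristic `≠ 2` and `F₁, …, Fₙ` field
extensions of `F` (given by embeddings `f i : F →+* K i`) such that
(II) for every `x ∈ F×`, `F× ∩ D_{F₁}⟨1,x⟩ ∩ … ∩ D_{Fₙ}⟨1,x⟩ = D_F⟨1,x⟩`, and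
`Fᵢ× = F×·(Fᵢ×)²` for each `i`.  Then `R(F) = F× ∩ R(F₁) ∩ … ∩ R(Fₙ)`. -/
theorem kaplansky_radical_of_free_product
    {F : Type*} [Field F] (hchar : ringChar F ≠ 2)
    {n : ℕ} (K : Fin n → Type*) [∀ i, Field (K i)] (f : ∀ i, F →+* K i)
    (hII : ∀ x : F, x ≠ 0 → ∀ z : F, z ≠ 0 →
      (z ∈ DSet F x ↔ ∀ i, f i z ∈ DSet (K i) (f i x)))
    (hIb : ∀ i, ∀ y : K i, y ≠ 0 → ∃ (c : F) (w : K i), c ≠ 0 ∧ y = f i c * w ^ 2) :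
    ∀ a : F, a ≠ 0 → (a ∈ KRad F ↔ ∀ i, f i a ∈ KRad (K i)) := by
  intro a ha
  constructor
  · rintro ⟨-, h⟩ i
    refine ⟨(map_ne_zero (f i)).2 ha, fun y hy => ?_⟩
    obtain ⟨c, w, hc, rfl⟩ := hIb i y hy
    obtain ⟨u, v, rfl⟩ := h c hc
    exact ⟨f i u * w, f i v * w, by simp only [map_sub, map_mul, map_pow]; ring⟩
  · intro h
    refine ⟨ha, fun b hb => ?_⟩
    have hD : b ∈ DSet F (-a) := (hII (-a) (neg_ne_zero.2 ha) b hb).2 fun i => by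
      have hbi : f i b ≠ 0 := (map_ne_zero (f i)).2 hb
      obtain ⟨u, v, huv⟩ := (h i).2 (f i b) hbi
      exact ⟨hbi, u, v, by rw [huv, map_neg]; ring⟩
    obtain ⟨-, u, v, huv⟩ := hD
    exact ⟨u, v, by rw [huv]; ring⟩
end

section
/- Let F be a field of characteristic not equal to 2 and let F₁, …, Fₙ be field extensions of F satisfying conditions (I) and (II). If each Fᵢ has trivial Kaplansky radical, i.e., R(Fᵢ) = (Fᵢ×)² for all i, then F has trivial Kaplansky radical: R(F) = F×². -/
/-- The Kaplansky radical contains the nonzero squares. -/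
theorem sq_mem_KRad {F : Type*} [Field F] (hchar : ringChar F ≠ 2) {c : F} (hc : c ≠ 0) :
    c ^ 2 ∈ KRad F := by
  have h2 : (2 : F) ≠ 0 := Ring.two_ne_zero hchar
  refine ⟨pow_ne_zero 2 hc, fun b _ => ⟨(b + 1) / 2, (b - 1) / (2 * c), ?_⟩⟩
  field_simp
  ring

/-- A field homomorphism whose image meets every square class maps radical to radical. -/
theorem map_mem_KRad {F L : Type*} [Field F] [Field L] (f : F →+* L)
    (hf : ∀ y : L, y ≠ 0 → ∃ (c : F) (w : L), c ≠ 0 ∧ y = f c * w ^ 2) {a : F}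
    (ha : a ∈ KRad F) : f a ∈ KRad L := by
  refine ⟨(map_ne_zero f).2 ha.1, fun y hy => ?_⟩
  obtain ⟨c, w, hc, rfl⟩ := hf y hy
  obtain ⟨u, v, rfl⟩ := ha.2 c hc
  refine ⟨f u * w, f v * w, ?_⟩
  simp only [map_sub, map_mul, map_pow]
  ring

/-- Let `F` be a field of characteristic `≠ 2` and `F₁, …, Fₙ` field
extensions of `F` satisfying conditions (I) and (II).  If each `Fᵢ` has trivial
Kaplansky radical, `R(Fᵢ) = (Fᵢ×)²`, then `F` has trivial Kaplansky radical:
`R(F) = F×²`. -/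
theorem trivial_radical_of_factors_trivial
    {F : Type*} [Field F] (hchar : ringChar F ≠ 2)
    {n : ℕ} (K : Fin n → Type*) [∀ i, Field (K i)] (f : ∀ i, F →+* K i)
    -- condition (I): F× ∩ (F₁×)² ∩ … ∩ (Fₙ×)² = F×² and Fᵢ× = F×·(Fᵢ×)²
    (hIa : ∀ z : F, z ≠ 0 → ((∀ i, ∃ w : K i, f i z = w ^ 2) ↔ ∃ c : F, z = c ^ 2))
    (hIb : ∀ i, ∀ y : K i, y ≠ 0 → ∃ (c : F) (w : K i), c ≠ 0 ∧ y = f i c * w ^ 2)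
    -- condition (II)
    (hII : ∀ x : F, x ≠ 0 → ∀ z : F, z ≠ 0 →
      (z ∈ DSet F x ↔ ∀ i, f i z ∈ DSet (K i) (f i x)))
    -- each Fᵢ has trivial radical
    (htriv : ∀ i, KRad (K i) = {y : K i | y ≠ 0 ∧ ∃ w : K i, y = w ^ 2}) :
    KRad F = {z : F | z ≠ 0 ∧ ∃ c : F, z = c ^ 2} := by
  ext a
  constructor
  · rintro ⟨ha, h⟩
    refine ⟨ha, (hIa a ha).1 fun i => ?_⟩
    have hmem := map_mem_KRad (f i) (hIb i) ⟨ha, h⟩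
    rw [htriv i] at hmem
    exact hmem.2
  · rintro ⟨ha, c, rfl⟩
    exact sq_mem_KRad hchar (pow_ne_zero_iff two_ne_zero |>.1 ha)
end

section
/- Let F be a field of characteristic not equal to 2 and let F₁, …, Fₙ be field extensions of F satisfying conditions (I) and (II). If R(Fᵢ) = Fᵢ× for all i, then R(F) = F×. -/
/-- Let `F` be a field of characteristic `≠ 2` and `F₁, …, Fₙ` field
extensions of `F` satisfying conditions (I) and (II).  If `R(Fᵢ) = Fᵢ×` for all `i`,
then `R(F) = F×`. -/
theorem full_radical_of_factors_full
    {F : Type*} [Field F] (hchar : ringChar F ≠ 2)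
    {n : ℕ} (K : Fin n → Type*) [∀ i, Field (K i)] (f : ∀ i, F →+* K i)
    -- condition (I): F× ∩ (F₁×)² ∩ … ∩ (Fₙ×)² = F×² and Fᵢ× = F×·(Fᵢ×)²
    (hIa : ∀ z : F, z ≠ 0 → ((∀ i, ∃ w : K i, f i z = w ^ 2) ↔ ∃ c : F, z = c ^ 2))
    (hIb : ∀ i, ∀ y : K i, y ≠ 0 → ∃ (c : F) (w : K i), c ≠ 0 ∧ y = f i c * w ^ 2)
    -- condition (II)
    (hII : ∀ x : F, x ≠ 0 → ∀ z : F, z ≠ 0 →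
      (z ∈ DSet F x ↔ ∀ i, f i z ∈ DSet (K i) (f i x)))
    -- each Fᵢ has full radical
    (hfull : ∀ i, KRad (K i) = {y : K i | y ≠ 0}) :
    KRad F = {a : F | a ≠ 0} := by
  ext a
  refine ⟨fun h => h.1, fun ha => ⟨ha, fun b hb => ?_⟩⟩
  have ha₀ : a ≠ 0 := ha
  have hD : b ∈ DSet F (-a) := (hII (-a) (neg_ne_zero.mpr ha₀) b hb).mpr fun i => by
    have hi : f i a ∈ KRad (K i) := by
      rw [hfull i]
      exact (map_ne_zero (f i)).mpr ha₀
    have hbi : f i b ≠ 0 := (map_ne_zero (f i)).mpr hb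
    obtain ⟨u, v, h⟩ := hi.2 (f i b) hbi
    exact ⟨hbi, u, v, by rw [h, map_neg]; ring⟩
  obtain ⟨-, u, v, h⟩ := hD
  exact ⟨u, v, by rw [h]; ring⟩
end

section
/- Let F be a field of characteristic not equal to 2 with F×/F×² finite, and let F₁ and H be field extensions of F such that: (i) the natural map F×/F×² → F₁×/(F₁×)² × H×/(H×)² induced by the inclusions is bijective; (ii) condition (II) holds for the pair F₁, H; (iii) R(F₁) = F₁× and R(H) = (H×)². Then the index of F×² in R(F) equals the index of (F₁×)² in F₁×, i.e., |R(F)/F×²| = |F₁×/(F₁×)²|. -/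
/-- Square-class relation on `F×`: two nonzero elements are related iff they differ
by a nonzero square.  `Quot (sqClassRel F)` is the square-class group `F×/F×²`. -/
def sqClassRel (F : Type*) [Field F] (a b : {x : F // x ≠ 0}) : Prop :=
  ∃ c : F, (a : F) = (b : F) * c ^ 2

/-- Square-class relation on the Kaplansky radical: `Quot (radClassRel F)` is the
group `R(F)/F×²`. -/
def radClassRel (F : Type*) [Field F] (a b : {x : F // x ∈ KRad F}) : Prop :=
  ∃ c : F, (a : F) = (b : F) * c ^ 2

theorem sqClassRel_equivalence (F : Type*) [Field F] : Equivalence (sqClassRel F) where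
  refl a := ⟨1, by simp⟩
  symm := by
    rintro ⟨a, ha⟩ ⟨b, hb⟩ ⟨c, hc⟩
    dsimp only at hc
    have hc0 : c ≠ 0 := by
      rintro rfl
      simp [ha] at hc
    refine ⟨c⁻¹, ?_⟩
    dsimp only
    rw [hc]
    field_simp
  trans := by
    rintro a b d ⟨c, hc⟩ ⟨e, he⟩
    exact ⟨e * c, by rw [hc, he]; ring⟩

/-- Membership in the Kaplansky radical in terms of value sets. -/
theorem mem_kRad_iff_forall_mem_dSet {F : Type*} [Field F] {a : F} (ha : a ≠ 0) :
    a ∈ KRad F ↔ ∀ b : F, b ≠ 0 → b ∈ DSet F (-a) := by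
  simp only [KRad, DSet, Set.mem_ofPred_eq, neg_mul, ← sub_eq_add_neg]
  exact ⟨fun h b hb => ⟨hb, h.2 b hb⟩, fun h => ⟨ha, fun b hb => (h b hb).2⟩⟩

theorem mul_sq_mem_dSet {F : Type*} [Field F] {x z w : F} (hw : w ≠ 0) (hz : z ∈ DSet F x) :
    z * w ^ 2 ∈ DSet F x := by
  obtain ⟨hz0, u, v, h⟩ := hz
  exact ⟨mul_ne_zero hz0 (pow_ne_zero 2 hw), u * w, v * w, by rw [h]; ring⟩

/-- If value sets over `F` are detected by two extensions, the first of which has full Kaplansky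
radical, and `F` represents all square classes of the second, then the Kaplansky radical of `F` is
the preimage of that of the second extension. -/
theorem mem_kRad_iff_map_mem_kRad {F F₁ H : Type*} [Field F] [Field F₁] [Field H]
    (f₁ : F →+* F₁) (g : F →+* H)
    (hsurj : ∀ y : H, y ≠ 0 → ∃ z : F, z ≠ 0 ∧ ∃ w : H, y = g z * w ^ 2)
    (hII : ∀ x : F, x ≠ 0 → ∀ z : F, z ≠ 0 →
      (z ∈ DSet F x ↔ (f₁ z ∈ DSet F₁ (f₁ x) ∧ g z ∈ DSet H (g x))))
    (hfull : KRad F₁ = {y : F₁ | y ≠ 0}) {a : F} (ha : a ≠ 0) :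
    a ∈ KRad F ↔ g a ∈ KRad H := by
  have hga : g a ≠ 0 := (map_ne_zero g).2 ha
  have hfa : f₁ a ≠ 0 := (map_ne_zero f₁).2 ha
  have hfa' : f₁ a ∈ KRad F₁ := by rw [hfull]; exact hfa
  rw [mem_kRad_iff_forall_mem_dSet hfa] at hfa'
  rw [mem_kRad_iff_forall_mem_dSet ha, mem_kRad_iff_forall_mem_dSet hga]
  constructor
  · intro h y hy
    obtain ⟨z, hz, w, rfl⟩ := hsurj y hy
    have hw : w ≠ 0 := by
      rintro rfl
      simp at hy
    have hgz := ((hII (-a) (neg_ne_zero.2 ha) z hz).1 (h z hz)).2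
    rw [map_neg] at hgz
    exact mul_sq_mem_dSet hw hgz
  · intro h b hb
    rw [hII (-a) (neg_ne_zero.2 ha) b hb, map_neg, map_neg]
    exact ⟨hfa' _ ((map_ne_zero f₁).2 hb), h _ ((map_ne_zero g).2 hb)⟩


/-- Let `F` be a field of characteristic `≠ 2` with `F×/F×²` finite, and
let `F₁` and `H` be field extensions of `F` such that: (i) the natural map
`F×/F×² → F₁×/(F₁×)² × H×/(H×)²` induced by the inclusions is bijective; (ii) condition
(II) holds for the pair `F₁, H`; (iii) `R(F₁) = F₁×` and `R(H) = (H×)²`.  Then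
`|R(F)/F×²| = |F₁×/(F₁×)²|`. -/
theorem card_radical_square_classes_eq_free_factor
    {F : Type*} [Field F] (hchar : ringChar F ≠ 2)
    (hfin : Finite (Quot (sqClassRel F)))
    (F₁ : Type*) [Field F₁] (f₁ : F →+* F₁)
    (H : Type*) [Field H] (g : F →+* H)
    -- (i) injectivity of F×/F×² → F₁×/(F₁×)² × H×/(H×)²
    (hinj : ∀ z : F, z ≠ 0 → (∃ w : F₁, f₁ z = w ^ 2) → (∃ w : H, g z = w ^ 2) →
      ∃ c : F, z = c ^ 2)
    -- (i) surjectivity of F×/F×² → F₁×/(F₁×)² × H×/(H×)²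
    (hsurj : ∀ (y₁ : F₁) (y₂ : H), y₁ ≠ 0 → y₂ ≠ 0 →
      ∃ z : F, z ≠ 0 ∧ (∃ w : F₁, y₁ = f₁ z * w ^ 2) ∧ (∃ w : H, y₂ = g z * w ^ 2))
    -- (ii) condition (II) for the pair F₁, H
    (hII : ∀ x : F, x ≠ 0 → ∀ z : F, z ≠ 0 →
      (z ∈ DSet F x ↔ (f₁ z ∈ DSet F₁ (f₁ x) ∧ g z ∈ DSet H (g x))))
    -- (iii) R(F₁) = F₁× and R(H) = (H×)²
    (hfull : KRad F₁ = {y : F₁ | y ≠ 0})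
    (htriv : KRad H = {y : H | y ≠ 0 ∧ ∃ w : H, y = w ^ 2}) :
    Nat.card (Quot (radClassRel F)) = Nat.card (Quot (sqClassRel F₁)) := by
  have hmem : ∀ {a : F}, a ≠ 0 → (a ∈ KRad F ↔ ∃ w : H, g a = w ^ 2) := by
    intro a ha
    have hsurjH : ∀ y : H, y ≠ 0 → ∃ z : F, z ≠ 0 ∧ ∃ w : H, y = g z * w ^ 2 := by
      intro y hy
      obtain ⟨z, hz, -, hw⟩ := hsurj 1 y one_ne_zero hy
      exact ⟨z, hz, hw⟩
    rw [mem_kRad_iff_map_mem_kRad f₁ g hsurjH hII hfull ha, htriv]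
    exact and_iff_right ((map_ne_zero g).2 ha)
  let φ : Quot (radClassRel F) → Quot (sqClassRel F₁) :=
    Quot.map (fun a => ⟨f₁ a, (map_ne_zero f₁).2 a.2.1⟩) (by
      rintro a b ⟨c, hc⟩
      exact ⟨f₁ c, by simp [hc]⟩)
  refine Nat.card_congr (Equiv.ofBijective φ ⟨?_, ?_⟩)
  · rintro ⟨a, ha⟩ ⟨b, hb⟩ hab
    obtain ⟨c, hc⟩ := (sqClassRel_equivalence F₁).quot_mk_eq_iff _ _ |>.1 hab
    dsimp only at hc
    obtain ⟨u, hu⟩ := (hmem ha.1).1 ha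
    obtain ⟨v, hv⟩ := (hmem hb.1).1 hb
    obtain ⟨d, hd⟩ := hinj (a * b) (mul_ne_zero ha.1 hb.1)
      ⟨f₁ b * c, by rw [map_mul, hc]; ring⟩ ⟨u * v, by rw [map_mul, hu, hv]; ring⟩
    have hb0 : b ≠ 0 := hb.1
    refine Quot.sound ⟨d / b, ?_⟩
    dsimp only
    rw [div_pow, ← hd]
    field_simp
  · rintro ⟨y, hy⟩
    obtain ⟨z, hz, ⟨w, hw⟩, v, hv⟩ := hsurj y 1 hy one_ne_zero
    have hv0 : v ≠ 0 := by
      rintro rfl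
      simp at hv
    have hzR : z ∈ KRad F := (hmem hz).2 ⟨v⁻¹, by
      rw [inv_pow]
      exact eq_inv_of_mul_eq_one_left hv.symm⟩
    exact ⟨Quot.mk _ ⟨z, hzR⟩,
      Quot.sound ((sqClassRel_equivalence F₁).symm (⟨w, hw⟩ : sqClassRel F₁ ⟨y, hy⟩ ⟨f₁ z, _⟩))⟩
end

section
/- Let F be a field of characteristic not equal to 2 having a rigid element a with a ∈ R(F) and R(F) ≠ F×. Then F is formally real (−1 is not a sum of squares in F) and R(F) = D_F⟨1,1⟩ = F×² ∪ aF×² (so F is a formally real quasi-Pythagorean field). -/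
/-- `a ∈ F×` is rigid: `a ∉ F×² ∪ (−1)·F×²` and `D_F⟨1,a⟩ = F×² ∪ aF×²`. -/
def IsRigid (F : Type*) [Field F] (a : F) : Prop :=
  a ≠ 0 ∧ (¬∃ c : F, a = c ^ 2) ∧ (¬∃ c : F, -a = c ^ 2) ∧
    ∀ z : F, z ≠ 0 →
      ((∃ u v : F, z = u ^ 2 + a * v ^ 2) ↔
        ((∃ c : F, z = c ^ 2) ∨ (∃ c : F, z = a * c ^ 2)))

theorem sq_mem_kRad {F : Type*} [Field F] (h2 : (2 : F) ≠ 0) {c : F} (hc : c ≠ 0) :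
    c ^ 2 ∈ KRad F := by
  refine ⟨pow_ne_zero 2 hc, fun b _ => ⟨(b + 1) / 2, (b - 1) / (2 * c), ?_⟩⟩
  field_simp
  ring

theorem mul_sq_mem_kRad {F : Type*} [Field F] {a c : F} (ha : a ∈ KRad F) (hc : c ≠ 0) :
    a * c ^ 2 ∈ KRad F := by
  refine ⟨mul_ne_zero ha.1 (pow_ne_zero 2 hc), fun b hb => ?_⟩
  obtain ⟨u, v, h⟩ := ha.2 b hb
  refine ⟨u, v / c, ?_⟩
  rw [h]
  field_simp

/-- If `-1` is a square, every element is a sum of two squares. -/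
theorem exists_eq_sq_add_sq_of_neg_one {F : Type*} [Field F] (h2 : (2 : F) ≠ 0) {i : F}
    (hi : -1 = i ^ 2) (z : F) : ∃ u v : F, z = u ^ 2 + v ^ 2 := by
  refine ⟨(z + 1) / 2, i * ((z - 1) / 2), ?_⟩
  rw [mul_pow, ← hi]
  field_simp
  ring

theorem exists_eq_sq_add_sq_of_mem_kRad {F : Type*} [Field F] (h2 : (2 : F) ≠ 0) {b : F}
    (hb : b ∈ KRad F) : ∃ u v : F, b = u ^ 2 + v ^ 2 := by
  obtain ⟨u, v, h⟩ := hb.2 (-1) (neg_ne_zero.mpr one_ne_zero)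
  by_cases hv : v = 0
  · exact exists_eq_sq_add_sq_of_neg_one h2 (i := u) (by simpa [hv] using h) b
  · refine ⟨u / v, 1 / v, ?_⟩
    field_simp
    linear_combination h

/-- A sum of two squares is represented by `⟨1, a⟩` when `a` lies in the Kaplansky radical. -/
theorem exists_eq_sq_add_mul_sq {F : Type*} [Field F] {a z : F} (ha : a ∈ KRad F)
    (hna : ¬∃ c : F, -a = c ^ 2) (hz : z ≠ 0) (h : ∃ u v : F, z = u ^ 2 + v ^ 2) :
    ∃ u v : F, z = u ^ 2 + a * v ^ 2 := by
  obtain ⟨u, v, huv⟩ := h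
  obtain ⟨s, t, hst⟩ := ha.2 z hz
  by_cases hu : u = 0
  · exact ⟨v, 0, by simp [huv, hu]⟩
  by_cases ht : t = 0
  · exact ⟨s, 0, by simp [hst, ht]⟩
  have hsv : s + v ≠ 0 := by
    intro h0
    refine hna ⟨u / t, ?_⟩
    field_simp
    linear_combination huv - hst - (s - v) * h0
  refine ⟨(s * v + z) / (s + v), t * u / (s + v), ?_⟩
  field_simp
  linear_combination (v ^ 2 - z) * hst + a * t ^ 2 * huv

/-- Let `F` be a field of characteristic `≠ 2` with a rigid element `a`
such that `a ∈ R(F)` and `R(F) ≠ F×`.  Then `F` is formally real (`−1` is not a sum of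
squares) and `R(F) = D_F⟨1,1⟩ = F×² ∪ aF×²`, i.e. `F` is a formally real
quasi-Pythagorean field. -/
theorem quasi_pythagorean_of_rigid_in_radical
    {F : Type*} [Field F] (hchar : ringChar F ≠ 2) {a : F} (ha : IsRigid F a)
    (haR : a ∈ KRad F) (hne : KRad F ≠ {b : F | b ≠ 0}) :
    ¬ IsSumSq (-1 : F) ∧
    KRad F = {z : F | z ≠ 0 ∧ ∃ u v : F, z = u ^ 2 + v ^ 2} ∧
    KRad F = {z : F | z ≠ 0 ∧ ((∃ c : F, z = c ^ 2) ∨ (∃ c : F, z = a * c ^ 2))} := by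
  obtain ⟨ha0, -, hna, hrig⟩ := ha
  have h2 : (2 : F) ≠ 0 := Ring.two_ne_zero hchar
  have hsum : ∀ z : F, z ≠ 0 → (∃ u v : F, z = u ^ 2 + v ^ 2) →
      (∃ c : F, z = c ^ 2) ∨ (∃ c : F, z = a * c ^ 2) := fun z hz h =>
    (hrig z hz).1 (exists_eq_sq_add_mul_sq haR hna hz h)
  have hrad : ∀ z : F, z ≠ 0 → (∃ c : F, z = c ^ 2) ∨ (∃ c : F, z = a * c ^ 2) →
      z ∈ KRad F := by
    rintro z hz (⟨c, rfl⟩ | ⟨c, rfl⟩)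
    · exact sq_mem_kRad h2 (by rintro rfl; simp at hz)
    · exact mul_sq_mem_kRad haR (by rintro rfl; simp at hz)
  refine ⟨fun hneg => ?_, ?_, ?_⟩
  · have hclass : ∀ z : F, IsSumSq z → (∃ c : F, z = c ^ 2) ∨ (∃ c : F, z = a * c ^ 2) := by
      intro z hz
      induction hz with
      | zero => exact Or.inl ⟨0, by simp⟩
      | sq_add x _ ih =>
        rename_i s _
        by_cases h0 : x * x + s = 0
        · exact Or.inl ⟨0, by simp [h0]⟩
        · obtain ⟨c, rfl⟩ | ⟨c, rfl⟩ := ih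
          · exact hsum _ h0 ⟨x, c, by ring⟩
          · exact (hrig _ h0).1 ⟨x, c, by ring⟩
    obtain ⟨i, hi⟩ | ⟨c, hc⟩ := hclass _ hneg
    · refine hne (Set.ext fun z => ⟨fun h => h.1, fun hz => ?_⟩)
      exact hrad z hz (hsum z hz (exists_eq_sq_add_sq_of_neg_one h2 hi z))
    · have hc0 : c ≠ 0 := by rintro rfl; simp at hc
      refine hna ⟨1 / c, ?_⟩
      field_simp
      linear_combination hc
  · exact Set.ext fun z => ⟨fun h => ⟨h.1, exists_eq_sq_add_sq_of_mem_kRad h2 h⟩,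
      fun h => hrad z h.1 (hsum z h.1 h.2)⟩
  · exact Set.ext fun z => ⟨fun h => ⟨h.1, hsum z h.1 (exists_eq_sq_add_sq_of_mem_kRad h2 h)⟩,
      fun h => hrad z h.1 h.2⟩
end

section
/- Let F be a field of characteristic not equal to 2 having a rigid element a with a ∈ R(F) and R(F) = F×. Then −1 ∈ F×² and F× = F×² ∪ aF×² (so F has exactly two square classes). -/
/-- Let `F` be a field of characteristic `≠ 2` with a rigid element `a`
such that `a ∈ R(F)` and `R(F) = F×`.  Then `−1 ∈ F×²` and `F× = F×² ∪ aF×²`, so `F`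
has exactly two square classes. -/
theorem two_square_classes_of_rigid_in_full_radical
    {F : Type*} [Field F] (hchar : ringChar F ≠ 2) {a : F} (ha : IsRigid F a)
    (haR : a ∈ KRad F) (hall : KRad F = {b : F | b ≠ 0}) :
    (∃ c : F, (-1 : F) = c ^ 2) ∧
    ∀ z : F, z ≠ 0 → ((∃ c : F, z = c ^ 2) ∨ (∃ c : F, z = a * c ^ 2)) := by
  obtain ⟨ha0, -, hna, hrep⟩ := ha
  have hclasses : ∀ z : F, z ≠ 0 → ((∃ c : F, z = c ^ 2) ∨ (∃ c : F, z = a * c ^ 2)) := by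
    intro z hz
    have hmem : -a ∈ KRad F := by
      rw [hall]
      exact neg_ne_zero.mpr ha0
    obtain ⟨u, v, huv⟩ := hmem.2 z hz
    exact (hrep z hz).mp ⟨u, v, by rw [huv]; ring⟩
  refine ⟨(hclasses (-1) (neg_ne_zero.mpr one_ne_zero)).resolve_right ?_, hclasses⟩
  rintro ⟨c, hc⟩
  exact hna ⟨a * c, by linear_combination a * hc⟩
end

section
/- Let F be a field of characteristic not equal to 2 whose square-class group F×/F×² has at least 4 elements. If F has a birigid element a (both a and −a are rigid), then F has trivial Kaplansky radical: R(F) = F×². -/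
/-- An element of the radical is represented by `⟨1, -x⟩` for every nonsquare `x`. -/
theorem exists_eq_sq_add_of_mem_KRad {F : Type*} [Field F] {r x : F} (hr : r ∈ KRad F)
    (hx : x ≠ 0) (hxs : ¬∃ c : F, x = c ^ 2) : ∃ u v : F, r = u ^ 2 + -x * v ^ 2 := by
  obtain ⟨u, v, h⟩ := hr.2 x hx
  have hv : v ≠ 0 := by
    rintro rfl
    exact hxs ⟨u, by simpa using h⟩
  refine ⟨u / v, 1 / v, ?_⟩
  field_simp
  linear_combination h

/-- Let `F` be a field of characteristic `≠ 2` whose square-class group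
`F×/F×²` has at least `4` elements (i.e. there exist nonzero `x, y` with `x`, `y` and
`x·y` all non-squares).  If `F` has a birigid element `a` (both `a` and `−a` are rigid),
then `F` has trivial Kaplansky radical: `R(F) = F×²`. -/
theorem trivial_radical_of_birigid
    {F : Type*} [Field F] (hchar : ringChar F ≠ 2)
    (h4 : ∃ x y : F, x ≠ 0 ∧ y ≠ 0 ∧ (¬∃ c : F, x = c ^ 2) ∧ (¬∃ c : F, y = c ^ 2) ∧
      (¬∃ c : F, x * y = c ^ 2))
    {a : F} (ha : IsRigid F a) (ha' : IsRigid F (-a)) :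
    KRad F = {z : F | z ≠ 0 ∧ ∃ c : F, z = c ^ 2} := by
  ext r
  constructor
  · intro hr
    refine ⟨hr.1, ?_⟩
    obtain ⟨ha0, has, _, hrep⟩ := ha
    obtain h | ⟨d, hd⟩ := (ha'.2.2.2 r hr.1).1 (exists_eq_sq_add_of_mem_KRad hr ha0 has)
    · exact h
    have hall : ∀ b : F, b ≠ 0 → (∃ c : F, b = c ^ 2) ∨ ∃ c : F, b = a * c ^ 2 := by
      intro b hb
      obtain ⟨u, v, h⟩ := hr.2 b hb
      exact (hrep b hb).1 ⟨u, d * v, by rw [h, hd]; ring⟩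
    obtain ⟨x, y, hx, hy, hxs, hys, hxys⟩ := h4
    obtain ⟨c, hc⟩ := (hall x hx).resolve_left hxs
    obtain ⟨e, he⟩ := (hall y hy).resolve_left hys
    exact absurd ⟨a * c * e, by rw [hc, he]; ring⟩ hxys
  · rintro ⟨hr, c, rfl⟩
    exact sq_mem_KRad hchar (by rintro rfl; simp at hr)
end
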